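/- (S1+SP is a sublogic of S3) Every theorem of S1+SP is a theorem of the Lewis system S3: for every modal formula φ, if φ is derivable in S1+SP (from the empty premise set), then φ is derivable in S3. -/

import Mathlib

/-- Modal formulas over countably many propositional variables x₀, x₁, …. -/
inductive Fm : Type
  | var : ℕ → Fm
  | neg : Fm → Fm
  | imp : Fm → Fm → Fm
  | box : Fm → Fm
deriving DecidableEq

namespace Fm

/-- ⊤ := x₀ → x₀ -/
def top : Fm := imp (var 0) (var 0)

/-- φ ∧ ψ := ¬(φ → ¬ψ) -/
def conj (φ ψ : Fm) : Fm := neg (imp φ (neg ψ))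

/-- φ ↔ ψ := (φ → ψ) ∧ (ψ → φ) -/
def biimp (φ ψ : Fm) : Fm := conj (imp φ ψ) (imp ψ φ)

/-- strict equivalence: φ ≡ ψ := □(φ → ψ) ∧ □(ψ → φ) -/
def equiv (φ ψ : Fm) : Fm := conj (box (imp φ ψ)) (box (imp ψ φ))

/-- φ[x := ψ]: substitution of ψ for all occurrences of the variable x in φ. -/
def subst (φ : Fm) (x : ℕ) (ψ : Fm) : Fm :=
  match φ with
  | var y => if y = x then ψ else var y
  | neg χ => neg (subst χ x ψ)
  | imp χ δ => imp (subst χ x ψ) (subst δ x ψ)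
  | box χ => box (subst χ x ψ)

/-- Propositional (two-valued) evaluation of a modal formula, treating
variables and boxed formulas as atoms. -/
def pEval (v : Fm → Bool) : Fm → Bool
  | var n => v (var n)
  | neg φ => !(pEval v φ)
  | imp φ ψ => !(pEval v φ) || pEval v ψ
  | box φ => v (box φ)

/-- φ has the form of a propositional tautology, i.e. φ is a substitution
instance of a propositional tautology. -/
def isTautInstance (φ : Fm) : Prop := ∀ v : Fm → Bool, pEval v φ = true

/-- The axioms (i)–(iii) of Lewis system S1 (Lemmon-style). -/
inductive S1Axiom : Fm → Prop
  | taut {φ} : isTautInstance φ → S1Axiom φ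
  | ax2 (φ) : S1Axiom (imp (box φ) φ)
  | ax3 (φ ψ χ) :
      S1Axiom (imp (conj (box (imp φ ψ)) (box (imp ψ χ))) (box (imp φ χ)))

/-- The identity axioms (iv)–(vi), i.e. the Substitution Principle SP. -/
inductive SPAxiom : Fm → Prop
  | ax4 (φ ψ) : SPAxiom (imp (equiv φ ψ) (equiv (neg φ) (neg ψ)))
  | ax5 (φ ψ φ' ψ') :
      SPAxiom (imp (conj (equiv φ ψ) (equiv φ' ψ'))
        (equiv (imp φ φ') (imp ψ ψ')))
  | ax6 (φ ψ) : SPAxiom (imp (equiv φ ψ) (equiv (box φ) (box ψ)))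

/-- Derivability in S1+SP from a set Φ of premises: axioms (i)–(vi),
modus ponens, and Axiom Necessitation AN restricted to axioms (i)–(iii). -/
inductive S1SP : Set Fm → Fm → Prop
  | prem {Φ φ} : φ ∈ Φ → S1SP Φ φ
  | axm {Φ φ} : S1Axiom φ → S1SP Φ φ
  | spAxm {Φ φ} : SPAxiom φ → S1SP Φ φ
  | mp {Φ φ ψ} : S1SP Φ (imp φ ψ) → S1SP Φ φ → S1SP Φ ψ
  | an {Φ φ} : S1Axiom φ → S1SP Φ (box φ)

end Fm

namespace Fm

/-- The axioms of Lewis system S3: the S1 axioms (i)–(iii) together with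
the scheme (3) □(φ→ψ) → □(□φ→□ψ). -/
inductive S3Axiom : Fm → Prop
  | s1 {φ} : S1Axiom φ → S3Axiom φ
  | ax3 (φ ψ) : S3Axiom (imp (box (imp φ ψ)) (box (imp (box φ) (box ψ))))

/-- Derivability in Lewis system S3 from a set Φ of premises: axioms
(i)–(iii),(3), modus ponens, Axiom Necessitation AN applicable to all axioms,
and Substitution of Proved Strict Equivalents SPSE. -/
inductive S3 : Set Fm → Fm → Prop
  | prem {Φ φ} : φ ∈ Φ → S3 Φ φ
  | axm {Φ φ} : S3Axiom φ → S3 Φ φ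
  | mp {Φ φ ψ} : S3 Φ (imp φ ψ) → S3 Φ φ → S3 Φ ψ
  | an {Φ φ} : S3Axiom φ → S3 Φ (box φ)
  | spse {Φ} (φ : Fm) (x : ℕ) {ψ ψ'} : S3 ∅ (equiv ψ ψ') →
      S3 Φ (equiv (subst φ x ψ) (subst φ x ψ'))

end Fm

namespace Fm

theorem s3_taut {φ : Fm} (h : isTautInstance φ) : S3 ∅ φ := S3.axm (.s1 (.taut h))

theorem s3_mp2 {a b c : Fm} (ha : S3 ∅ a) (hb : S3 ∅ b)
    (h : isTautInstance (imp a (imp b c))) : S3 ∅ c :=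
  .mp (.mp (s3_taut h) ha) hb

theorem s3_K (a b : Fm) : S3 ∅ (imp (box (imp a b)) (imp (box a) (box b))) :=
  s3_mp2 (.axm (.ax3 a b)) (.axm (.s1 (.ax2 (imp (box a) (box b))))) (by
    intro v; simp only [pEval]; grind)

theorem s3_mono {a b : Fm} (h : isTautInstance (imp a b)) : S3 ∅ (imp (box a) (box b)) :=
  .mp (s3_K a b) (.an (.s1 (.taut h)))

theorem s3_mono2 {a b c : Fm} (h : isTautInstance (imp a (imp b c))) :
    S3 ∅ (imp (box a) (imp (box b) (box c))) :=
  s3_mp2 (s3_mono h) (s3_K b c) (by intro v; simp only [pEval]; grind)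

theorem s3_sp {φ : Fm} (h : SPAxiom φ) : S3 ∅ φ := by
  cases h with
  | ax4 a b =>
    refine s3_mp2 (s3_mono (a := imp a b) (b := imp (neg b) (neg a)) ?_)
      (s3_mono (a := imp b a) (b := imp (neg a) (neg b)) ?_) ?_ <;>
    · intro v; simp only [pEval, equiv, conj]; grind
  | ax5 a b c d =>
    refine s3_mp2
      (s3_mono2 (a := imp b a) (b := imp c d) (c := imp (imp a c) (imp b d)) ?_)
      (s3_mono2 (a := imp a b) (b := imp d c) (c := imp (imp b d) (imp a c)) ?_) ?_ <;>
    · intro v; simp only [pEval, equiv, conj]; grind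
  | ax6 a b =>
    refine s3_mp2 (.axm (.ax3 a b)) (.axm (.ax3 b a)) ?_
    intro v; simp only [pEval, equiv, conj]; grind

theorem s3_of_s1sp {Φ : Set Fm} {φ : Fm} (h : S1SP Φ φ) (hΦ : Φ = ∅) : S3 ∅ φ := by
  induction h with
  | prem h => subst hΦ; exact h.elim
  | axm h => exact .axm (.s1 h)
  | spAxm h => exact s3_sp h
  | mp _ _ ih1 ih2 => exact .mp ih1 ih2
  | an h => exact .an (.s1 h)

end Fm

open Fm in
/-- S1+SP is a sublogic of S3: every theorem of S1+SP is a theorem of S3. -/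
theorem S1SP_sublogic_of_S3 (φ : Fm) (h : S1SP ∅ φ) : S3 ∅ φ := by
  exact s3_of_s1sp h rfl
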